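/- Let N ≥ 3 be an integer and θ > 0. Then there exists δ > 0 such that there are no η₁, η₂ with 1 ≤ η₁ < η₂ ≤ 1 + δ and no continuously differentiable function ζ : [η₁, η₂] → ℝ with ζ(η₁) = 0 and ζ(η) > 0 for all η ∈ (η₁, η₂], satisfying for all η ∈ (η₁, η₂] the equation −ζ(η)ζ'(η) + (θ+1)ζ(η)²/η + ζ(η)·((2Nθ−(2N−1))η − (2Nθ−1)) + N·η·(η−1)·((Nθ−(N−1))η − (Nθ−1)) = 0. -/

import Mathlib

/-- A function continuous on `[a, b]` and differentiable in the interior, which vanishes at `a` and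
is positive afterwards, has positive derivative at points where its value is arbitrarily small. -/
theorem exists_deriv_pos_of_pos_of_eq_zero {f : ℝ → ℝ} {a b ε : ℝ} (hab : a < b)
    (hf : ContinuousOn f (Set.Icc a b)) (hd : DifferentiableOn ℝ f (Set.Ioo a b))
    (ha : f a = 0) (hpos : ∀ x ∈ Set.Ioc a b, 0 < f x) (hε : 0 < ε) :
    ∃ x ∈ Set.Ioo a b, f x < ε ∧ 0 < deriv f x := by
  have hsmall : ∀ᶠ x in nhdsWithin a (Set.Icc a b), f x < ε :=
    (hf a (Set.left_mem_Icc.2 hab.le)).eventually_lt_const (by rwa [ha])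
  rw [nhdsWithin_Icc_eq_nhdsGE hab] at hsmall
  obtain ⟨u, hau, hu⟩ := (mem_nhdsGE_iff_exists_Ico_subset' hab).1 hsmall
  obtain ⟨c, hac, hc⟩ := exists_between (lt_min hau hab)
  obtain ⟨hcu, hcb⟩ := lt_min_iff.1 hc
  obtain ⟨x, hx, hslope⟩ := exists_deriv_eq_slope f hac
    (hf.mono (Set.Icc_subset_Icc_right hcb.le)) (hd.mono (Set.Ioo_subset_Ioo_right hcb.le))
  refine ⟨x, ⟨hx.1, hx.2.trans hcb⟩, hu ⟨hx.1.le, hx.2.trans hcu⟩, ?_⟩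
  rw [hslope, ha, sub_zero]
  exact div_pos (hpos c ⟨hac, hcb.le⟩) (sub_pos.2 hac)

/-- For `N ≥ 3` and `θ > 0` the reduced radial equation (3.3) admits no positive
solution branch starting from a zero at `η₁` near `1` (type 2 solutions). -/
theorem stmt_4 (N : ℕ) (hN : 3 ≤ N) (θ : ℝ) (hθ : 0 < θ) :
    ∃ δ > (0:ℝ), ∀ η₁ η₂ : ℝ, 1 ≤ η₁ → η₁ < η₂ → η₂ ≤ 1 + δ →
      ∀ ζ : ℝ → ℝ, ContDiffOn ℝ 1 ζ (Set.Icc η₁ η₂) →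
        ζ η₁ = 0 → (∀ η ∈ Set.Ioc η₁ η₂, 0 < ζ η) →
        ¬ (∀ η ∈ Set.Ioc η₁ η₂,
          -(ζ η * derivWithin ζ (Set.Icc η₁ η₂) η) + (θ + 1) * (ζ η) ^ 2 / η
          + ζ η * ((2 * (N:ℝ) * θ - (2 * (N:ℝ) - 1)) * η - (2 * (N:ℝ) * θ - 1))
          + (N:ℝ) * η * (η - 1)
            * (((N:ℝ) * θ - ((N:ℝ) - 1)) * η - ((N:ℝ) * θ - 1)) = 0) := by
  have hN' : (3 : ℝ) ≤ N := by exact_mod_cast hN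
  refine ⟨1 / (4 * θ), by positivity, ?_⟩
  intro η₁ η₂ h1 h12 h2 ζ hζ hζ0 hpos heq
  obtain ⟨x, hx, hsmall, hderiv⟩ := exists_deriv_pos_of_pos_of_eq_zero h12 hζ.continuousOn
    ((hζ.differentiableOn one_ne_zero).mono Set.Ioo_subset_Icc_self) hζ0 hpos
    (ε := 1 / (θ + 1)) (by positivity)
  have hxIoc := Set.Ioo_subset_Ioc_self hx
  have h := heq x hxIoc
  have hz := hpos x hxIoc
  rw [derivWithin_of_mem_nhds (Icc_mem_nhds hx.1 hx.2)] at h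
  have hx1 : 1 < x := h1.trans_lt hx.1
  have hθx : θ * (x - 1) ≤ 1 / 4 := by
    have : x - 1 ≤ 1 / (4 * θ) := by linarith [hx.2]
    calc θ * (x - 1) ≤ θ * (1 / (4 * θ)) := by gcongr
      _ = 1 / 4 := by field_simp
  have hA : (2 * (N:ℝ) * θ - (2 * (N:ℝ) - 1)) * x - (2 * (N:ℝ) * θ - 1) ≤ -1 := by
    nlinarith
  have hB : ((N:ℝ) * θ - ((N:ℝ) - 1)) * x - ((N:ℝ) * θ - 1) ≤ 0 := by
    nlinarith
  have hquad : (θ + 1) * (ζ x) ^ 2 / x < ζ x := by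
    have hz1 : (θ + 1) * ζ x < 1 := by
      rw [lt_div_iff₀ (by positivity)] at hsmall
      linarith
    rw [div_lt_iff₀ (by linarith)]
    nlinarith
  have hlast := mul_nonpos_of_nonneg_of_nonpos
    (show 0 ≤ (N:ℝ) * x * (x - 1) from mul_nonneg (by positivity) (by linarith)) hB
  have hmid := mul_le_mul_of_nonneg_left hA hz.le
  linarith [mul_pos hz hderiv]
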